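/- arXiv:1409.5141 — 4 statements merged into one kernel-verified Lean document; each statement's English description precedes it below -/
import Mathlib

section
/- Let s ≥ 1 and t ≥ 1. Let x = (x^1, x^2, …, x^s) ∈ ℝ^{st} be a vector with all entries nonnegative, obtained by concatenating s blocks x^i, each of length t. Let y = (‖x^1‖₁, ‖x^2‖₁, …, ‖x^s‖₁) ∈ ℝ^s be the vector of ℓ1-norms of the blocks. If y ∈ PP_s, then x ∈ PP_{st}. -/
/-- The parity polytope over an index type `I`: the convex hull of the 0/1 vectors
with an even number of ones. -/
def parityPolytope (I : Type) : Set (I → ℝ) :=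
  convexHull ℝ {e : I → ℝ | (∀ i, e i = 0 ∨ e i = 1) ∧ Even (Nat.card {i // e i = 1})}

/-- Placing the `i`-th entry at position `f i` of the `i`-th block. -/
def placeInBlocks {I J : Type} [DecidableEq J] (f : I → J) : (I → ℝ) →ₗ[ℝ] (I × J → ℝ) where
  toFun e p := if p.2 = f p.1 then e p.1 else 0
  map_add' a b := by ext p; by_cases h : p.2 = f p.1 <;> simp [h]
  map_smul' c a := by ext p; by_cases h : p.2 = f p.1 <;> simp [h]

theorem placeInBlocks_apply {I J : Type} [DecidableEq J] (f : I → J) (e : I → ℝ) (p : I × J) :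
    placeInBlocks f e p = if p.2 = f p.1 then e p.1 else 0 := rfl

theorem card_placeInBlocks_eq_one {I J : Type} [DecidableEq J] (f : I → J) (e : I → ℝ) :
    Nat.card {p // placeInBlocks f e p = 1} = Nat.card {i // e i = 1} := by
  have key (p : I × J) (hp : placeInBlocks f e p = 1) : p.2 = f p.1 ∧ e p.1 = 1 := by
    rw [placeInBlocks_apply] at hp
    split_ifs at hp with h
    · exact ⟨h, hp⟩
    · exact absurd hp zero_ne_one
  exact Nat.card_congr
    { toFun := fun p => ⟨p.1.1, (key p.1 p.2).2⟩
      invFun := fun i => ⟨(i.1, f i.1), by simpa [placeInBlocks_apply] using i.2⟩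
      left_inv := fun p => Subtype.ext (Prod.ext rfl (key p.1 p.2).1.symm)
      right_inv := fun _ => rfl }

theorem placeInBlocks_mem_parityPolytope {I J : Type} [DecidableEq J] (f : I → J) {y : I → ℝ}
    (hy : y ∈ parityPolytope I) : placeInBlocks f y ∈ parityPolytope (I × J) := by
  have hsub : parityPolytope I ⊆ placeInBlocks f ⁻¹' parityPolytope (I × J) := by
    refine convexHull_min ?_ ((convex_convexHull ℝ _).linear_preimage _)
    rintro e ⟨h01, heven⟩
    refine subset_convexHull ℝ _ ⟨fun p => ?_, by rwa [card_placeInBlocks_eq_one]⟩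
    rw [placeInBlocks_apply]
    split_ifs
    · exact h01 p.1
    · exact Or.inl rfl
  exact hsub hy

/-- Distributing each entry of a point of the parity polytope over a block, in proportions given
by a point of the standard simplex, stays in the parity polytope. -/
theorem mul_stdSimplex_mem_parityPolytope {I J : Type} [Finite I] [Fintype J] {y : I → ℝ}
    (hy : y ∈ parityPolytope I) {w : I → J → ℝ} (hw : ∀ i, w i ∈ stdSimplex ℝ J) :
    (fun p : I × J => w p.1 p.2 * y p.1) ∈ parityPolytope (I × J) := by
  classical
  let T : (I → J → ℝ) →ₗ[ℝ] (I × J → ℝ) :=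
    { toFun := fun v p => v p.1 p.2 * y p.1
      map_add' := fun a b => by ext p; simp [add_mul]
      map_smul' := fun c a => by ext p; simp [mul_assoc] }
  have hw' : w ∈ convexHull ℝ
      (Set.univ.pi fun _ : I => Set.range fun j : J => (Pi.single j 1 : J → ℝ)) := by
    rw [convexHull_pi]
    intro i _
    rw [convexHull_rangle_single_eq_stdSimplex]
    exact hw i
  have hsub : convexHull ℝ
      (Set.univ.pi fun _ : I => Set.range fun j : J => (Pi.single j 1 : J → ℝ)) ⊆
      T ⁻¹' parityPolytope (I × J) := by
    refine convexHull_min ?_ ((convex_convexHull ℝ _).linear_preimage _)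
    intro v hv
    choose f hf using fun i => hv i (Set.mem_univ i)
    have hT : T v = placeInBlocks f y := by
      ext p
      simp [T, placeInBlocks_apply, ← hf, Pi.single_apply]
    rw [Set.mem_preimage, hT]
    exact placeInBlocks_mem_parityPolytope f hy
  exact hsub hw'

/-- If the vector of block-wise ℓ1 norms of a nonnegative vector
`x ∈ ℝ^{st}` (with `s` blocks of length `t`) lies in the parity polytope `PP_s`,
then `x` lies in the parity polytope `PP_{st}`. -/
theorem stmt4 (s t : ℕ) (hs : 1 ≤ s) (ht : 1 ≤ t)
    (x : Fin s → Fin t → ℝ) (hx : ∀ i j, 0 ≤ x i j)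
    (y : Fin s → ℝ) (hy : ∀ i, y i = ∑ j, |x i j|)
    (hyP : y ∈ parityPolytope (Fin s)) :
    (fun p : Fin s × Fin t => x p.1 p.2) ∈ parityPolytope (Fin s × Fin t) := by
  have hsum (i : Fin s) : y i = ∑ j, x i j := by
    rw [hy i]
    exact Finset.sum_congr rfl fun j _ => abs_of_nonneg (hx i j)
  have hw (i : Fin s) : ∃ w ∈ stdSimplex ℝ (Fin t), ∀ j, w j * y i = x i j := by
    by_cases h : y i = 0
    · have hz := (Finset.sum_eq_zero_iff_of_nonneg fun j _ => hx i j).1 ((hsum i).symm.trans h)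
      exact ⟨Pi.single ⟨0, ht⟩ 1, single_mem_stdSimplex ℝ _, fun j => by
        rw [h, mul_zero, hz j (Finset.mem_univ j)]⟩
    · have hnonneg : 0 ≤ y i := hsum i ▸ Finset.sum_nonneg fun j _ => hx i j
      refine ⟨fun j => x i j / y i, ⟨fun j => div_nonneg (hx i j) hnonneg, ?_⟩,
        fun j => div_mul_cancel₀ _ h⟩
      rw [← Finset.sum_div, ← hsum i, div_self h]
  choose w hwmem hwmul using hw
  simpa only [hwmul] using mul_stdSimplex_mem_parityPolytope hyP hwmem
end

section
/- Let F_q be any finite field, d ≥ 1, and let h ∈ F_q^d have all entries nonzero. Let C be the single parity-check code defined by h and let C^N be the single parity-check code defined by the all-ones check (1,…,1) ∈ F_q^d. Let V = conv(F(C)) and V^N = conv(F(C^N)), convex hulls taken in the real vector space of matrices with rows indexed by F_q∖{0} and columns by {1,…,d}. Then a matrix u lies in V if and only if D(q,h)^{-1}u lies in V^N; equivalently, a matrix w lies in V^N if and only if D(q,h)w lies in V. -/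
/-- The tight code polytope `V(h)`: the convex hull of the Flanagan-embedded matrices of
the codewords of the single parity-check code defined by the check vector `h`. -/
def tightV (F : Type) [Field F] [Fintype F] [DecidableEq F] (d : ℕ) (h : Fin d → F) :
    Set ({x : F // x ≠ 0} → Fin d → ℝ) :=
  convexHull ℝ {M | ∃ c : Fin d → F, (∑ j, h j * c j) = 0 ∧
    M = fun (i : {x : F // x ≠ 0}) (j : Fin d) => if (i : F) = c j then (1 : ℝ) else 0}

/-- The rotation of matrices by a nowhere vanishing vector `k`, as a linear map. -/
def flanaganRotation {F : Type} [Field F] {d : ℕ} (k : Fin d → F) (hk : ∀ j, k j ≠ 0) :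
    ({x : F // x ≠ 0} → Fin d → ℝ) →ₗ[ℝ] ({x : F // x ≠ 0} → Fin d → ℝ) where
  toFun u := fun i j => u ⟨(i : F) * k j, mul_ne_zero i.2 (hk j)⟩ j
  map_add' _ _ := rfl
  map_smul' _ _ := rfl

theorem flanaganRotation_mem_tightV {F : Type} [Field F] [Fintype F] [DecidableEq F] {d : ℕ}
    {g k : Fin d → F} (hk : ∀ j, k j ≠ 0) {u : {x : F // x ≠ 0} → Fin d → ℝ}
    (hu : u ∈ tightV F d g) : flanaganRotation k hk u ∈ tightV F d (fun j => g j * k j) := by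
  have hmem := Set.mem_image_of_mem (flanaganRotation k hk) hu
  rw [tightV, LinearMap.image_convexHull] at hmem
  refine convexHull_mono ?_ hmem
  rintro _ ⟨_, ⟨c, hc, rfl⟩, rfl⟩
  refine ⟨fun j => c j / k j, ?_, ?_⟩
  · rw [← hc]
    refine Finset.sum_congr rfl fun j _ => ?_
    have := hk j
    field_simp
  · funext i j
    simp [flanaganRotation, eq_div_iff (hk j)]

theorem flanaganRotation_flanaganRotation {F : Type} [Field F] {d : ℕ} {k l : Fin d → F}
    (hk : ∀ j, k j ≠ 0) (hl : ∀ j, l j ≠ 0) (hkl : ∀ j, k j * l j = 1)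
    (u : {x : F // x ≠ 0} → Fin d → ℝ) : flanaganRotation k hk (flanaganRotation l hl u) = u := by
  funext i j
  simp [flanaganRotation, mul_assoc, hkl]

/-- Rotation of the tight code polytope: `u ∈ V(h)` iff `D(q,h)⁻¹ u ∈ V^N`,
and `w ∈ V^N` iff `D(q,h) w ∈ V(h)`, where `V^N` is the tight code polytope of the
all-ones check and `(D(q,h)w)_{α,j} = w_{α·h_j, j}`. -/
theorem stmt5 (F : Type) [Field F] [Fintype F] [DecidableEq F]
    (d : ℕ) (hd : 1 ≤ d) (h : Fin d → F) (hnz : ∀ j, h j ≠ 0) :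
    (∀ u : {x : F // x ≠ 0} → Fin d → ℝ,
      u ∈ tightV F d h ↔
        (fun (i : {x : F // x ≠ 0}) (j : Fin d) =>
            u ⟨(i : F) * (h j)⁻¹, mul_ne_zero i.2 (inv_ne_zero (hnz j))⟩ j)
          ∈ tightV F d (fun _ => 1))
    ∧ (∀ w : {x : F // x ≠ 0} → Fin d → ℝ,
      w ∈ tightV F d (fun _ => 1) ↔
        (fun (i : {x : F // x ≠ 0}) (j : Fin d) =>
            w ⟨(i : F) * h j, mul_ne_zero i.2 (hnz j)⟩ j)
          ∈ tightV F d h) := by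
  have hinv : ∀ j, (h j)⁻¹ ≠ 0 := fun j => inv_ne_zero (hnz j)
  have to_one {u : {x : F // x ≠ 0} → Fin d → ℝ} (hu : u ∈ tightV F d h) :
      flanaganRotation (fun j => (h j)⁻¹) hinv u ∈ tightV F d (fun _ => 1) := by
    simpa [hnz] using flanaganRotation_mem_tightV hinv hu
  have of_one {w : {x : F // x ≠ 0} → Fin d → ℝ} (hw : w ∈ tightV F d (fun _ => 1)) :
      flanaganRotation h hnz w ∈ tightV F d h := by
    simpa using flanaganRotation_mem_tightV hnz hw
  refine ⟨fun u => ⟨to_one, fun hu => ?_⟩, fun w => ⟨of_one, fun hw => ?_⟩⟩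
  · rw [← flanaganRotation_flanaganRotation hnz hinv (fun j => mul_inv_cancel₀ (hnz j)) u]
    exact of_one hu
  · rw [← flanaganRotation_flanaganRotation hinv hnz (fun j => inv_mul_cancel₀ (hnz j)) w]
    exact to_one hw
end

section
/- Let F_q be any finite field, d ≥ 1, and let h ∈ F_q^d have all entries nonzero. Let C be the single parity-check code defined by h and C^N the single parity-check code defined by the all-ones check; set V = conv(F(C)) and V^N = conv(F(C^N)). Let v be any real matrix with rows indexed by F_q∖{0} and columns by {1,…,d}, and set v^N = D(q,h)^{-1}v. If u^N ∈ V^N satisfies ‖u^N − v^N‖ ≤ ‖w − v^N‖ for all w ∈ V^N (Frobenius/Euclidean norm), i.e. u^N is a Euclidean projection of v^N onto V^N, then u := D(q,h)u^N lies in V and satisfies ‖u − v‖ ≤ ‖w − v‖ for all w ∈ V, i.e. u is a Euclidean projection of v onto V. -/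
/-- The rotation `D(q,g)`, whose `(i, j)` entry at `M` is the entry of `M` at `(i * g j, j)`. -/
def checkRotation {F ι : Type*} [Field F] (g : ι → F) (hg : ∀ j, g j ≠ 0) :
    ({x : F // x ≠ 0} → ι → ℝ) →ₗ[ℝ] ({x : F // x ≠ 0} → ι → ℝ) where
  toFun M i j := M ⟨(i : F) * g j, mul_ne_zero i.2 (hg j)⟩ j
  map_add' _ _ := rfl
  map_smul' _ _ := rfl

theorem checkRotation_apply {F ι : Type*} [Field F] (g : ι → F) (hg : ∀ j, g j ≠ 0)
    (M : {x : F // x ≠ 0} → ι → ℝ) (i : {x : F // x ≠ 0}) (j : ι) :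
    checkRotation g hg M i j = M ⟨(i : F) * g j, mul_ne_zero i.2 (hg j)⟩ j := rfl

/-- Rotations by `g` and by `g⁻¹` cancel. -/
theorem checkRotation_checkRotation_inv {F ι : Type*} [Field F] (g : ι → F) (hg : ∀ j, g j ≠ 0)
    (M : {x : F // x ≠ 0} → ι → ℝ) :
    checkRotation g hg (checkRotation (fun j => (g j)⁻¹) (fun j => inv_ne_zero (hg j)) M) = M := by
  ext i j
  simp [checkRotation_apply, hg j]

/-- Rotating by `g` maps the polytope of the check `h` into that of the check `h * g`. -/
theorem checkRotation_mem_tightV {F : Type} [Field F] [Fintype F] [DecidableEq F] {d : ℕ}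
    {h g k : Fin d → F} (hg : ∀ j, g j ≠ 0) (hk : ∀ j, k j = h j * g j)
    {M : {x : F // x ≠ 0} → Fin d → ℝ} (hM : M ∈ tightV F d h) :
    checkRotation g hg M ∈ tightV F d k := by
  have hmem := Set.mem_image_of_mem (checkRotation g hg) hM
  unfold tightV at hmem ⊢
  rw [LinearMap.image_convexHull] at hmem
  refine convexHull_mono ?_ hmem
  rintro _ ⟨_, ⟨c, hc, rfl⟩, rfl⟩
  refine ⟨fun j => c j * (g j)⁻¹, ?_, ?_⟩
  · rw [← hc]
    refine Finset.sum_congr rfl fun j _ => ?_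
    rw [hk]
    field_simp [hg j]
  · ext i j
    simp only [checkRotation_apply, eq_mul_inv_iff_mul_eq₀ (hg j)]

/-- Rotations preserve the squared Frobenius norm. -/
theorem sum_sq_checkRotation {F ι : Type*} [Field F] [Fintype F] [DecidableEq F] [Fintype ι]
    (g : ι → F) (hg : ∀ j, g j ≠ 0) (M : {x : F // x ≠ 0} → ι → ℝ) :
    ∑ i, ∑ j, (checkRotation g hg M i j) ^ 2 = ∑ i, ∑ j, (M i j) ^ 2 := by
  rw [Finset.sum_comm, Finset.sum_comm (f := fun i j => (M i j) ^ 2)]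
  refine Finset.sum_congr rfl fun j _ => ?_
  let e : {x : F // x ≠ 0} ≃ {x : F // x ≠ 0} :=
    (Equiv.mulRight₀ (g j) (hg j)).subtypeEquiv fun x => by simp [hg j]
  exact Equiv.sum_comp e fun i => (M i j) ^ 2

/-- Projection onto the tight code polytope via rotation: if `u^N` is a
Euclidean projection of `v^N = D(q,h)⁻¹ v` onto the normalized polytope `V^N`, then
`u = D(q,h) u^N` is a Euclidean projection of `v` onto `V(h)`. (Euclidean/Frobenius
distances are expressed via sums of squares.) -/
theorem stmt6 (F : Type) [Field F] [Fintype F] [DecidableEq F]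
    (d : ℕ) (hd : 1 ≤ d) (h : Fin d → F) (hnz : ∀ j, h j ≠ 0)
    (v uN : {x : F // x ≠ 0} → Fin d → ℝ)
    (vN : {x : F // x ≠ 0} → Fin d → ℝ)
    (hvN : vN = fun (i : {x : F // x ≠ 0}) (j : Fin d) =>
        v ⟨(i : F) * (h j)⁻¹, mul_ne_zero i.2 (inv_ne_zero (hnz j))⟩ j)
    (huN : uN ∈ tightV F d (fun _ => 1))
    (hproj : ∀ w ∈ tightV F d (fun _ => 1),
        (∑ i, ∑ j, (uN i j - vN i j) ^ 2) ≤ ∑ i, ∑ j, (w i j - vN i j) ^ 2)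
    (u : {x : F // x ≠ 0} → Fin d → ℝ)
    (hu : u = fun (i : {x : F // x ≠ 0}) (j : Fin d) =>
        uN ⟨(i : F) * h j, mul_ne_zero i.2 (hnz j)⟩ j) :
    u ∈ tightV F d h ∧
      ∀ w ∈ tightV F d h,
        (∑ i, ∑ j, (u i j - v i j) ^ 2) ≤ ∑ i, ∑ j, (w i j - v i j) ^ 2 := by
  obtain rfl : u = checkRotation h hnz uN := hu
  have hinv : ∀ j, (h j)⁻¹ ≠ 0 := fun j => inv_ne_zero (hnz j)
  obtain rfl : vN = checkRotation (fun j => (h j)⁻¹) hinv v := hvN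
  refine ⟨checkRotation_mem_tightV hnz (fun j => (one_mul _).symm) huN, fun w hw => ?_⟩
  have hle := hproj _ (checkRotation_mem_tightV hinv (fun j => (mul_inv_cancel₀ (hnz j)).symm) hw)
  simp only [← Pi.sub_apply] at hle ⊢
  rw [← map_sub, sum_sq_checkRotation, ← sum_sq_checkRotation h hnz, map_sub,
    checkRotation_checkRotation_inv h hnz v] at hle
  exact hle
end

section
/- Let d ≥ 1 and let C = {c ∈ F_4^d : ∑_{j=1}^d c_j = 0} be the single parity-check code over the four-element field F_4 defined by the all-ones check. A real matrix F with rows indexed by the three nonzero elements of F_4 and columns indexed by {1,…,d} equals the embedded matrix F(c) of some codeword c ∈ C if and only if: (a) every entry lies in {0,1}; (b) every column sum is at most 1; and (c) the three row sums ∑_j f_{ij} (i ranging over the nonzero elements of F_4) are either all even or all odd. -/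
theorem two_eq_zero_of_card_eq_four {F : Type*} [Field F] [Fintype F]
    (hcard : Fintype.card F = 4) : (2 : F) = 0 := by
  have h : ((Fintype.card F : ℕ) : F) = 0 := Nat.cast_card_eq_zero F
  rw [hcard] at h
  have h' : (2 : F) * 2 = 0 := by
    rw [← h]
    norm_num
  exact mul_self_eq_zero.mp h'

theorem exists_univ_eq_of_card_eq_four {F : Type*} [Field F] [Fintype F] [DecidableEq F]
    (hcard : Fintype.card F = 4) :
    ∃ a : F, a ≠ 0 ∧ a ≠ 1 ∧ a + 1 ≠ 0 ∧ (Finset.univ : Finset F) = {0, 1, a, a + 1} := by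
  have h2 := two_eq_zero_of_card_eq_four hcard
  obtain ⟨a, ha⟩ : ∃ a : F, a ∉ ({0, 1} : Finset F) := by
    by_contra! h
    have hle := Finset.card_le_card (fun x _ => h x : (Finset.univ : Finset F) ⊆ {0, 1})
    have hle' := Finset.card_le_two (a := (0 : F)) (b := 1)
    rw [Finset.card_univ] at hle
    omega
  simp only [Finset.mem_insert, Finset.mem_singleton, not_or] at ha
  have ha1 : a + 1 ≠ 0 := fun h => ha.2 (by linear_combination h - h2)
  refine ⟨a, ha.1, ha.2, ha1, ?_⟩
  symm
  apply Finset.eq_univ_of_card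
  rw [hcard]
  clear h2
  rw [Finset.card_insert_of_notMem, Finset.card_insert_of_notMem, Finset.card_insert_of_notMem,
    Finset.card_singleton] <;> simp_all [eq_comm]

/-- A natural-number combination of the elements of the four-element field vanishes iff the
coefficients of the nonzero elements all have the same parity. -/
theorem sum_nsmul_eq_zero_iff {F : Type*} [Field F] [Fintype F] [DecidableEq F]
    (hcard : Fintype.card F = 4) (n : F → ℕ) :
    ∑ x, n x • x = 0 ↔ (∀ x ≠ 0, Even (n x)) ∨ (∀ x ≠ 0, Odd (n x)) := by
  have h2 := two_eq_zero_of_card_eq_four hcard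
  obtain ⟨a, ha0, ha1, ha, huniv⟩ := exists_univ_eq_of_card_eq_four hcard
  have hall (P : F → Prop) : (∀ x ≠ 0, P x) ↔ P 1 ∧ P a ∧ P (a + 1) := by
    refine ⟨fun h => ⟨h 1 one_ne_zero, h a ha0, h _ ha⟩, fun h x hx => ?_⟩
    have hmem := Finset.mem_univ x
    rw [huniv] at hmem
    simp only [Finset.mem_insert, Finset.mem_singleton] at hmem
    rcases hmem with rfl | rfl | rfl | rfl
    exacts [absurd rfl hx, h.1, h.2.1, h.2.2]
  have hsum : ∑ x, n x • x = n 1 + n a * a + n (a + 1) * (a + 1) := by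
    rw [huniv, Finset.sum_insert, Finset.sum_insert, Finset.sum_insert, Finset.sum_singleton]
    · simp only [nsmul_eq_mul, mul_zero, mul_one, zero_add, add_assoc]
    all_goals
      clear h2
      simp_all [eq_comm]
  have heven {k : ℕ} (hk : Even k) : (k : F) = 0 := by
    obtain ⟨m, rfl⟩ := hk
    push_cast
    linear_combination (m : F) * h2
  have hodd {k : ℕ} (hk : Odd k) : (k : F) = 1 := by
    obtain ⟨m, rfl⟩ := hk
    push_cast
    linear_combination (m : F) * h2
  have h11 : 1 + (a + 1) = a := by linear_combination h2
  have haa : a + (a + 1) = 1 := by linear_combination a * h2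
  have haa1 : 1 + a + (a + 1) = 0 := by linear_combination (a + 1) * h2
  have h1a : 1 + a ≠ 0 := by rwa [add_comm]
  rw [hall, hall, hsum]
  rcases Nat.even_or_odd (n 1) with h | h <;> rcases Nat.even_or_odd (n a) with h' | h' <;>
    rcases Nat.even_or_odd (n (a + 1)) with h'' | h'' <;>
    simp only [h, h', h'', heven, hodd, zero_mul, one_mul, add_zero, zero_add, ← Nat.not_even_iff_odd,
      ← Nat.not_odd_iff_even, not_true, and_true, and_false, or_false, h11, haa, haa1,
      one_ne_zero, ha0, ha, h1a] <;>
    simp_all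

theorem sum_eq_sum_card_fiber_nsmul {ι F : Type*} [Fintype ι] [Fintype F] [DecidableEq F]
    [AddCommMonoid F] (c : ι → F) :
    ∑ j, c j = ∑ x, Nat.card {j // c j = x} • x := by
  rw [← Finset.sum_fiberwise' Finset.univ c (fun x => x)]
  simp [Nat.card_eq_fintype_card, Fintype.card_subtype]

/-- A 0/1 vector indexed by the nonzero elements of `F`, with sum at most one, is the indicator
of an element of `F`. -/
theorem exists_eq_indicator {F : Type*} [Zero F] [Fintype F] [DecidableEq F]
    (v : {x : F // x ≠ 0} → ℝ) (h01 : ∀ i, v i = 0 ∨ v i = 1) (hsum : ∑ i, v i ≤ 1) :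
    ∃ x : F, ∀ i : {x : F // x ≠ 0}, v i = if (i : F) = x then 1 else 0 := by
  by_cases h : ∃ i, v i = 1
  · obtain ⟨i, hi⟩ := h
    refine ⟨i, fun k => ?_⟩
    split_ifs with hk
    · rw [Subtype.ext hk, hi]
    · refine (h01 k).resolve_right fun hk1 => ?_
      have hle : ∑ l ∈ {i, k}, v l ≤ ∑ l, v l :=
        Finset.sum_le_sum_of_subset_of_nonneg (Finset.subset_univ _) fun l _ _ => by
          rcases h01 l with hl | hl <;> simp [hl]
      rw [Finset.sum_pair fun hik => hk (congrArg Subtype.val hik.symm), hi, hk1] at hle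
      linarith
  · push Not at h
    exact ⟨0, fun k => by simp [k.2, (h01 k).resolve_right (h k)]⟩

theorem sum_eq_zero_iff_parity_card_fiber {ι F : Type*} [Fintype ι] [Field F] [Fintype F]
    [DecidableEq F] (hcard : Fintype.card F = 4) (c : ι → F) :
    ∑ j, c j = 0 ↔
      (∀ i : {x : F // x ≠ 0},
        Even (Nat.card {j // (if (i : F) = c j then (1 : ℝ) else 0) = 1})) ∨
      (∀ i : {x : F // x ≠ 0},
        Odd (Nat.card {j // (if (i : F) = c j then (1 : ℝ) else 0) = 1})) := by
  have hfiber (x : F) : Nat.card {j // (if x = c j then (1 : ℝ) else 0) = 1} =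
      Nat.card {j // c j = x} :=
    Nat.card_congr (Equiv.subtypeEquivRight fun j => by simp [eq_comm])
  simp only [sum_eq_sum_card_fiber_nsmul c, sum_nsmul_eq_zero_iff hcard, hfiber, Subtype.forall]

/-- Characterization of embedded matrices of codewords of the single
parity-check code over `F_4` defined by the all-ones check (Flanagan embedding):
a 0/1 matrix with column sums at most 1 is the embedding of a codeword iff its three
row sums (counts of ones) are either all even or all odd. -/
theorem stmt19 (F : Type) [Field F] [Fintype F] [DecidableEq F]
    (hcard : Fintype.card F = 4)
    (d : ℕ) (hd : 1 ≤ d)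
    (M : {x : F // x ≠ 0} → Fin d → ℝ) :
    (∃ c : Fin d → F, (∑ j, c j) = 0 ∧
        M = fun (i : {x : F // x ≠ 0}) (j : Fin d) =>
          if (i : F) = c j then (1 : ℝ) else 0)
    ↔ ((∀ i j, M i j = 0 ∨ M i j = 1)
        ∧ (∀ j, (∑ i, M i j) ≤ 1)
        ∧ ((∀ i : {x : F // x ≠ 0}, Even (Nat.card {j : Fin d // M i j = 1}))
            ∨ (∀ i : {x : F // x ≠ 0}, Odd (Nat.card {j : Fin d // M i j = 1})))) := by
  constructor
  · rintro ⟨c, hc, rfl⟩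
    refine ⟨fun i j => ?_, fun j => ?_, (sum_eq_zero_iff_parity_card_fiber hcard c).mp hc⟩
    · by_cases h : (i : F) = c j <;> simp [h]
    · rw [Finset.sum_boole]
      exact_mod_cast Finset.card_le_one.mpr fun a ha b hb => by
        rw [Finset.mem_filter] at ha hb
        exact Subtype.ext (ha.2.trans hb.2.symm)
  · rintro ⟨h01, hcol, hpar⟩
    choose c hc using fun j => exists_eq_indicator (fun i => M i j) (h01 · j) (hcol j)
    obtain rfl : M = fun (i : {x : F // x ≠ 0}) j => if (i : F) = c j then (1 : ℝ) else 0 :=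
      funext fun i => funext fun j => hc j i
    exact ⟨c, (sum_eq_zero_iff_parity_card_fiber hcard c).mpr hpar, rfl⟩
end
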